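/- Let K ≥ 1, let z : Fin K → {0,1} with S := #{i : z(i) = 1} even, and let p ∈ ℝ. Define the noisy GHZ density matrix ρ_p := (1 − p) · (outer product G_K G_K†) + (p / 2^K) · I, where I is the identity matrix on (Fin K → Fin 2) → ℂ. Then the trace Tr(M_z · ρ_p) = (1 − p) · (−1)^{S/2}. (This trace value governs the success probability (2 − p)/2 of the entanglement-assisted protocol with the white-noise-affected GHZ state.) -/

import Mathlib

open Matrix

/-- Pauli matrices: `pauli 0 = σ₁` (Pauli-X) and `pauli 1 = σ₂` (Pauli-Y). -/
noncomputable def pauli : Fin 2 → Matrix (Fin 2) (Fin 2) ℂ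
  | 0 => !![0, 1; 1, 0]
  | 1 => !![0, -Complex.I; Complex.I, 0]

/-- `Mz K z` is the tensor (Kronecker) product over the `K` sites of `σ₁` at
sites with `z i = 0` and `σ₂` at sites with `z i = 1`:
`(Mz K z) f g = ∏ i, σ_{1 + z i} (f i) (g i)`. -/
noncomputable def Mz (K : ℕ) (z : Fin K → Fin 2) :
    Matrix (Fin K → Fin 2) (Fin K → Fin 2) ℂ :=
  Matrix.of fun f g => ∏ i, pauli (z i) (f i) (g i)

/-- The `K`-qubit GHZ state `(|0…0⟩ + |1…1⟩)/√2` as a vector on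
`(Fin K → Fin 2) → ℂ`. -/
noncomputable def GHZ (K : ℕ) : (Fin K → Fin 2) → ℂ :=
  fun f => if (∀ i, f i = 0) ∨ (∀ i, f i = 1) then ((1 / Real.sqrt 2 : ℝ) : ℂ) else 0

/-- The noisy GHZ density matrix
`ρ_p = (1 - p)·|G_K⟩⟨G_K| + (p/2^K)·I` (white noise). -/
noncomputable def noisyGHZ (K : ℕ) (p : ℝ) :
    Matrix (Fin K → Fin 2) (Fin K → Fin 2) ℂ :=
  (1 - (p : ℂ)) • Matrix.of (fun f g => GHZ K f * (starRingEnd ℂ) (GHZ K g)) +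
    ((p : ℂ) / 2 ^ K) • (1 : Matrix (Fin K → Fin 2) (Fin K → Fin 2) ℂ)

theorem pauli_apply_self (a b : Fin 2) : pauli a b b = 0 := by
  fin_cases a <;> fin_cases b <;> simp [pauli]

theorem pauli_apply_zero_one (a : Fin 2) :
    pauli a 0 1 = if a = 1 then -Complex.I else 1 := by
  fin_cases a <;> simp [pauli]

theorem pauli_apply_one_zero (a : Fin 2) :
    pauli a 1 0 = if a = 1 then Complex.I else 1 := by
  fin_cases a <;> simp [pauli]

theorem Mz_apply_self {K : ℕ} (hK : 1 ≤ K) (z f : Fin K → Fin 2) : Mz K z f f = 0 :=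
  Finset.prod_eq_zero (Finset.mem_univ (⟨0, hK⟩ : Fin K)) (pauli_apply_self _ _)

theorem Mz_apply_zero_one {K : ℕ} (z : Fin K → Fin 2) :
    Mz K z 0 1 = (-Complex.I) ^ (Finset.univ.filter (fun i => z i = 1)).card := by
  simp [Mz, pauli_apply_zero_one, Finset.prod_ite]

theorem Mz_apply_one_zero {K : ℕ} (z : Fin K → Fin 2) :
    Mz K z 1 0 = Complex.I ^ (Finset.univ.filter (fun i => z i = 1)).card := by
  simp [Mz, pauli_apply_one_zero, Finset.prod_ite]

theorem GHZ_eq_ite (K : ℕ) (f : Fin K → Fin 2) :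
    GHZ K f = if f = 0 ∨ f = 1 then ((1 / Real.sqrt 2 : ℝ) : ℂ) else 0 := by
  simp [GHZ, funext_iff]

theorem conj_GHZ (K : ℕ) (f : Fin K → Fin 2) : (starRingEnd ℂ) (GHZ K f) = GHZ K f := by
  rw [GHZ_eq_ite]
  split_ifs
  · exact Complex.conj_ofReal _
  · exact map_zero _

theorem sum_mul_GHZ {K : ℕ} (hK : 1 ≤ K) (h : (Fin K → Fin 2) → ℂ) :
    ∑ f, h f * GHZ K f = (h 0 + h 1) * ((1 / Real.sqrt 2 : ℝ) : ℂ) := by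
  have hne : (0 : Fin K → Fin 2) ≠ 1 := fun h01 => by
    simpa using congrFun h01 ⟨0, hK⟩
  rw [← Finset.sum_subset (Finset.subset_univ {0, 1}), Finset.sum_pair hne]
  · simp [GHZ_eq_ite, add_mul]
  · intro f _ hf
    rw [GHZ_eq_ite, if_neg (by simpa using hf), mul_zero]

theorem trace_mul_GHZ_outer {K : ℕ} (hK : 1 ≤ K)
    (A : Matrix (Fin K → Fin 2) (Fin K → Fin 2) ℂ) :
    (A * Matrix.of (fun f g => GHZ K f * (starRingEnd ℂ) (GHZ K g))).trace =
      (A 0 0 + A 0 1 + A 1 0 + A 1 1) / 2 := by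
  have hsq : ((1 / Real.sqrt 2 : ℝ) : ℂ) * ((1 / Real.sqrt 2 : ℝ) : ℂ) = 1 / 2 := by
    rw [← Complex.ofReal_mul, div_mul_div_comm, Real.mul_self_sqrt zero_le_two]
    norm_num
  simp only [Matrix.trace, Matrix.diag_apply, Matrix.mul_apply, Matrix.of_apply, conj_GHZ,
    ← mul_assoc, ← Finset.sum_mul, sum_mul_GHZ hK]
  linear_combination (A 0 0 + A 0 1 + A 1 0 + A 1 1) * hsq

/-- If the number `S` of sites where `z i = 1` is even, then
`Tr(M_z · ρ_p) = (1 - p)·(-1)^{S/2}` for the white-noise-affected GHZ state. -/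
theorem trace_Mz_noisyGHZ_even (K : ℕ) (hK : 1 ≤ K) (z : Fin K → Fin 2)
    (hS : Even (Finset.univ.filter (fun i => z i = 1)).card) (p : ℝ) :
    (Mz K z * noisyGHZ K p).trace =
      (1 - (p : ℂ)) *
        (-1 : ℂ) ^ ((Finset.univ.filter (fun i => z i = 1)).card / 2) := by
  have htr : (Mz K z).trace = 0 :=
    Finset.sum_eq_zero fun f _ => Mz_apply_self hK z f
  rw [noisyGHZ, Matrix.mul_add, Matrix.mul_smul, Matrix.mul_smul, Matrix.mul_one,
    Matrix.trace_add, Matrix.trace_smul, Matrix.trace_smul, htr, trace_mul_GHZ_outer hK,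
    Mz_apply_self hK, Mz_apply_self hK, Mz_apply_zero_one, Mz_apply_one_zero, hS.neg_pow]
  obtain ⟨m, hm⟩ := hS.two_dvd
  rw [hm, Nat.mul_div_cancel_left m two_pos, pow_mul, Complex.I_sq, smul_zero, smul_eq_mul]
  ring
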